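/- arXiv:math/0009104 — 4 statements merged into one kernel-verified Lean document; each statement's English description precedes it below -/
import Mathlib

section
/- For every integer g ≥ 1 and every integer N ≥ 2g+1, the greatest common divisor of the set {p^{2g} − 1 : p prime, p > N} equals n_g = ∏_ℓ ℓ^{e_ℓ(g)}. In particular this gcd is the same for all N ≥ 2g+1, so n_g is the gcd of all p^{2g}−1 where p runs through all primes larger than a sufficiently large fixed number. -/
/-- The exponent `e_ℓ(g)` of the prime `ℓ` in `n_g`: for odd `ℓ` with `(ℓ-1) ∣ 2g` it is the
largest `k` such that `ℓ^(k-1)*(ℓ-1) ∣ 2g`; for odd `ℓ` with `(ℓ-1) ∤ 2g` it is `0`;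
and `e_2(g)` is the largest `k` such that `2^(k-2) ∣ 2g`. -/
def paperExp (ℓ g : ℕ) : ℕ :=
  if ℓ = 2 then
    Nat.findGreatest (fun k => 2 ^ (k - 2) ∣ 2 * g) (2 * g + 2)
  else if (ℓ - 1) ∣ 2 * g then
    Nat.findGreatest (fun k => ℓ ^ (k - 1) * (ℓ - 1) ∣ 2 * g) (2 * g + 1)
  else 0

/-- `n_g := ∏_ℓ ℓ^{e_ℓ(g)}`, the product running over all primes `ℓ`
(a finite product since `e_ℓ(g) = 0` for `ℓ - 1 > 2g`). -/
noncomputable def paperN (g : ℕ) : ℕ := ∏ᶠ (ℓ : ℕ) (_ : ℓ.Prime), ℓ ^ paperExp ℓ g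

open ArithmeticFunction in
theorem carmichael_dvd_iff_forall_units_pow_eq_one {n : ℕ} (hn : n ≠ 0) (m : ℕ) :
    carmichael n ∣ m ↔ ∀ u : (ZMod n)ˣ, u ^ m = 1 := by
  rw [carmichael_eq_exponent hn, Monoid.exponent_dvd_iff_forall_pow_eq_one]

theorem dvd_pow_sub_one_iff_natCast_pow_eq_one {n a m : ℕ} (ha : 0 < a) :
    n ∣ a ^ m - 1 ↔ (a : ZMod n) ^ m = 1 := by
  rw [← ZMod.natCast_eq_zero_iff, Nat.cast_sub (Nat.one_le_pow _ _ ha), sub_eq_zero]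
  push_cast
  rfl

open ArithmeticFunction in
theorem dvd_pow_sub_one_of_carmichael_dvd {n a m : ℕ} (hn : n ≠ 0) (ha : 0 < a)
    (h : a.Coprime n) (hm : carmichael n ∣ m) : n ∣ a ^ m - 1 := by
  rw [dvd_pow_sub_one_iff_natCast_pow_eq_one ha, ← ZMod.coe_unitOfCoprime a h,
    ← Units.val_pow_eq_pow_val, (carmichael_dvd_iff_forall_units_pow_eq_one hn m).1 hm, Units.val_one]

open ArithmeticFunction in
/-- By Dirichlet's theorem, primes larger than any bound represent all units modulo `n`. -/
theorem carmichael_dvd_of_forall_prime_gt {n m N : ℕ} (hn : n ≠ 0)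
    (h : ∀ p : ℕ, p.Prime → N < p → n ∣ p ^ m - 1) : carmichael n ∣ m := by
  rw [carmichael_dvd_iff_forall_units_pow_eq_one hn]
  intro u
  have : NeZero n := ⟨hn⟩
  obtain ⟨p, hpN, hp, hpu⟩ := Nat.forall_exists_prime_gt_and_eq_mod u.isUnit N
  have hdvd := h p hp hpN
  rw [dvd_pow_sub_one_iff_natCast_pow_eq_one hp.pos, hpu] at hdvd
  exact Units.ext (by simpa using hdvd)

theorem carmichael_two_pow_dvd_two_mul_iff (k g : ℕ) :
    ArithmeticFunction.carmichael (2 ^ k) ∣ 2 * g ↔ 2 ^ (k - 2) ∣ 2 * g := by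
  obtain rfl | hk := eq_or_ne k 2
  · rw [ArithmeticFunction.carmichael_two_pow_of_le_two le_rfl]
    simp
  · rw [ArithmeticFunction.carmichael_two_pow_of_ne_two hk]

theorem Nat.le_of_prime_pow_dvd {ℓ j m : ℕ} (hℓ : ℓ.Prime) (hm : 0 < m) (h : ℓ ^ j ∣ m) :
    j ≤ m :=
  (Nat.lt_pow_self hℓ.one_lt).le.trans (Nat.le_of_dvd hm h)

theorem carmichael_prime_pow_paperExp_dvd {ℓ g : ℕ} (hℓ : ℓ.Prime) :
    ArithmeticFunction.carmichael (ℓ ^ paperExp ℓ g) ∣ 2 * g := by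
  unfold paperExp
  split_ifs with h2 hd
  · subst h2
    rw [carmichael_two_pow_dvd_two_mul_iff]
    exact Nat.findGreatest_spec (P := fun k => 2 ^ (k - 2) ∣ 2 * g) (Nat.zero_le _) (by simp)
  · have hspec := Nat.findGreatest_spec (P := fun k => ℓ ^ (k - 1) * (ℓ - 1) ∣ 2 * g)
      (Nat.zero_le (2 * g + 1)) (by simpa using hd)
    rw [ArithmeticFunction.carmichael_pow_of_prime_ne_two _ hℓ h2]
    obtain h0 | hpos := Nat.eq_zero_or_pos
      (Nat.findGreatest (fun k => ℓ ^ (k - 1) * (ℓ - 1) ∣ 2 * g) (2 * g + 1))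
    · simp [h0]
    · rwa [Nat.totient_prime_pow hℓ hpos]
  · rw [pow_zero, ← pow_zero ℓ, ArithmeticFunction.carmichael_pow_of_prime_ne_two _ hℓ h2]
    simp

theorem le_paperExp_of_carmichael_dvd {ℓ k g : ℕ} (hg : 1 ≤ g) (hℓ : ℓ.Prime)
    (h : ArithmeticFunction.carmichael (ℓ ^ k) ∣ 2 * g) : k ≤ paperExp ℓ g := by
  obtain rfl | hk := Nat.eq_zero_or_pos k
  · exact Nat.zero_le _
  unfold paperExp
  split_ifs with h2 hd
  · subst h2
    rw [carmichael_two_pow_dvd_two_mul_iff] at h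
    have := Nat.le_of_prime_pow_dvd hℓ (by omega) h
    exact Nat.le_findGreatest (by omega) h
  all_goals
    rw [ArithmeticFunction.carmichael_pow_of_prime_ne_two _ hℓ h2, Nat.totient_prime_pow hℓ hk] at h
  · have := Nat.le_of_prime_pow_dvd hℓ (by omega) (dvd_of_mul_right_dvd h)
    exact Nat.le_findGreatest (by omega) h
  · exact absurd (dvd_of_mul_left_dvd h) hd

theorem le_of_paperExp_ne_zero {ℓ g : ℕ} (hg : 1 ≤ g) (h : paperExp ℓ g ≠ 0) :
    ℓ ≤ 2 * g + 1 := by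
  unfold paperExp at h
  split_ifs at h with h2 hd
  · omega
  · have := Nat.le_of_dvd (by omega) hd
    omega
  · exact absurd rfl h

theorem paperN_eq_prod {g : ℕ} (hg : 1 ≤ g) :
    paperN g = ∏ ℓ ∈ Finset.range (2 * g + 2) with ℓ.Prime, ℓ ^ paperExp ℓ g := by
  refine finprod_cond_eq_prod_of_cond_iff _ fun {ℓ} hne => ?_
  have hexp : paperExp ℓ g ≠ 0 := fun h => hne (by rw [h, pow_zero])
  have := le_of_paperExp_ne_zero hg hexp
  simp only [Finset.mem_filter, Finset.mem_range]
  exact ⟨fun hp => ⟨by omega, hp⟩, fun hp => hp.2⟩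

theorem pow_paperExp_dvd_paperN {ℓ g : ℕ} (hg : 1 ≤ g) (hℓ : ℓ.Prime) :
    ℓ ^ paperExp ℓ g ∣ paperN g := by
  by_cases h : paperExp ℓ g = 0
  · simp [h]
  have := le_of_paperExp_ne_zero hg h
  rw [paperN_eq_prod hg]
  exact Finset.dvd_prod_of_mem (fun ℓ => ℓ ^ paperExp ℓ g)
    (Finset.mem_filter.2 ⟨Finset.mem_range.2 (by omega), hℓ⟩)

theorem paperN_dvd_of_forall_prime {g m : ℕ} (hg : 1 ≤ g)
    (h : ∀ ℓ : ℕ, ℓ.Prime → ℓ ≤ 2 * g + 1 → ℓ ^ paperExp ℓ g ∣ m) : paperN g ∣ m := by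
  rw [paperN_eq_prod hg]
  refine Finset.prod_dvd_of_isRelPrime (fun p hp q hq hpq => ?_) fun ℓ hℓ => ?_
  · exact Nat.coprime_iff_isRelPrime.1 (Nat.Coprime.pow _ _
      ((Nat.coprime_primes (Finset.mem_filter.1 hp).2 (Finset.mem_filter.1 hq).2).2 hpq))
  · obtain ⟨hlt, hp⟩ := Finset.mem_filter.1 hℓ
    exact h ℓ hp (by have := Finset.mem_range.1 hlt; omega)

/-- For every `g ≥ 1` and `N ≥ 2g+1`, the gcd of `{p^(2g) - 1 : p prime, p > N}`
equals `n_g`: `n_g` divides each `p^(2g) - 1`, and every common divisor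
of the `p^(2g) - 1` divides `n_g`. -/
theorem gcd_pow_sub_one_eq_paperN (g N : ℕ) (hg : 1 ≤ g) (hN : 2 * g + 1 ≤ N) :
    (∀ p : ℕ, p.Prime → N < p → paperN g ∣ p ^ (2 * g) - 1) ∧
    (∀ d : ℕ, (∀ p : ℕ, p.Prime → N < p → d ∣ p ^ (2 * g) - 1) → d ∣ paperN g) := by
  refine ⟨fun p hp hNp => paperN_dvd_of_forall_prime hg fun ℓ hℓ hle => ?_, fun d hd => ?_⟩
  · exact dvd_pow_sub_one_of_carmichael_dvd (pow_ne_zero _ hℓ.ne_zero) hp.pos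
      (((Nat.coprime_primes hp hℓ).2 (by omega)).pow_right _)
      (carmichael_prime_pow_paperExp_dvd hℓ)
  · refine (Nat.dvd_iff_prime_pow_dvd_dvd _ _).2 fun ℓ k hℓ hk => ?_
    have hcar := carmichael_dvd_of_forall_prime_gt (pow_ne_zero k hℓ.ne_zero)
      fun p hp hNp => hk.trans (hd p hp hNp)
    exact (pow_dvd_pow ℓ (le_paperExp_of_carmichael_dvd hg hℓ hcar)).trans
      (pow_paperExp_dvd_paperN hg hℓ)
end

section
/- For every integer g ≥ 1, every prime ℓ, and every integer N, there exists a prime p > N such that ℓ^{e_ℓ(g)+1} does not divide p^{2g} − 1. (Hence the exponent e_ℓ(g) in the gcd of the numbers p^{2g} − 1 over large primes p is exact.) -/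
/-- If the Carmichael function of `q` does not divide `n`, there are arbitrarily large primes `p`
with `p ^ n` not congruent to `1` modulo `q`. -/
theorem exists_prime_gt_not_dvd_pow_sub_one_of_not_carmichael_dvd {q n : ℕ} (hq : q ≠ 0)
    (h : ¬ ArithmeticFunction.carmichael q ∣ n) (N : ℕ) :
    ∃ p : ℕ, p.Prime ∧ N < p ∧ ¬ q ∣ p ^ n - 1 := by
  have : NeZero q := ⟨hq⟩
  rw [ArithmeticFunction.carmichael_eq_exponent hq,
    Monoid.exponent_dvd_iff_forall_pow_eq_one] at h
  push Not at h
  obtain ⟨u, hu⟩ := h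
  obtain ⟨p, hpN, hp, hpu⟩ := Nat.forall_exists_prime_gt_and_eq_mod u.isUnit N
  refine ⟨p, hp, hpN, fun hdvd ↦ hu <| Units.ext ?_⟩
  rw [← CharP.cast_eq_zero_iff (ZMod q) q, Nat.cast_sub (Nat.one_le_pow _ _ hp.pos), sub_eq_zero,
    Nat.cast_pow, hpu, Nat.cast_one] at hdvd
  simpa using hdvd

theorem not_carmichael_pow_paperExp_add_one_dvd {g ℓ : ℕ} (hg : 1 ≤ g) (hℓ : ℓ.Prime) :
    ¬ ArithmeticFunction.carmichael (ℓ ^ (paperExp ℓ g + 1)) ∣ 2 * g := by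
  intro h
  by_cases h2 : ℓ = 2
  · subst h2
    have he : paperExp 2 g = Nat.findGreatest (fun k => 2 ^ (k - 2) ∣ 2 * g) (2 * g + 2) :=
      if_pos rfl
    have hge : 2 ≤ paperExp 2 g := by
      rw [he]
      exact Nat.le_findGreatest (by lia) (by simp)
    rw [ArithmeticFunction.carmichael_two_pow_of_ne_two (by lia)] at h
    have hlt := (Nat.lt_two_pow_self).trans_le (Nat.le_of_dvd (by lia) h)
    have hle : paperExp 2 g + 1 ≤ paperExp 2 g := by
      conv_rhs => rw [he]
      exact Nat.le_findGreatest (by lia) h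
    lia
  · rw [ArithmeticFunction.carmichael_pow_of_prime_ne_two _ hℓ h2,
      Nat.totient_prime_pow_succ hℓ] at h
    have hd : ℓ - 1 ∣ 2 * g := dvd_of_mul_left_dvd h
    have he : paperExp ℓ g =
        Nat.findGreatest (fun k => ℓ ^ (k - 1) * (ℓ - 1) ∣ 2 * g) (2 * g + 1) := by
      rw [paperExp, if_neg h2, if_pos hd]
    have hlt := (Nat.lt_pow_self hℓ.one_lt).trans_le
      (Nat.le_of_dvd (by lia) (dvd_of_mul_right_dvd h))
    have hle : paperExp ℓ g + 1 ≤ paperExp ℓ g := by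
      conv_rhs => rw [he]
      exact Nat.le_findGreatest (by lia) h
    lia

/-- For every `g ≥ 1`, every prime `ℓ`, and every `N`, there is a prime `p > N` such
that `ℓ^(e_ℓ(g)+1)` does not divide `p^(2g) - 1`; hence the exponent of `ℓ` in the gcd
of the numbers `p^(2g) - 1` over large primes `p` is exactly `e_ℓ(g)`. -/
theorem exists_prime_not_dvd_pow_sub_one (g ℓ N : ℕ) (hg : 1 ≤ g) (hℓ : ℓ.Prime) :
    ∃ p : ℕ, p.Prime ∧ N < p ∧ ¬ ℓ ^ (paperExp ℓ g + 1) ∣ p ^ (2 * g) - 1 :=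
  exists_prime_gt_not_dvd_pow_sub_one_of_not_carmichael_dvd (pow_ne_zero _ hℓ.ne_zero)
    (not_carmichael_pow_paperExp_add_one_dvd hg hℓ) N
end

section
/- The following gcd evaluations hold: the gcd of {p^2 − 1 : p prime, p > 3} is 24; the gcd of {p^4 − 1 : p prime, p > 5} is 240; the gcd of {p^6 − 1 : p prime, p > 7} is 504; and the gcd of {p^8 − 1 : p prime, p > 9} is 480. -/
/-- If every residue coprime to `n` has `k`-th power `1` modulo `n`, then `n` divides `p ^ k - 1`
for every prime `p > m`, provided that `n` divides a power of `m!`. -/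
theorem Nat.Prime.dvd_pow_sub_one_of_forall_residue {n k m j p : ℕ} (hp : p.Prime) (hmp : m < p)
    (hn : 0 < n) (hm : n ∣ m.factorial ^ j)
    (h : ∀ r < n, r.gcd n = 1 → r ^ k % n = 1 % n) : n ∣ p ^ k - 1 := by
  have hcop : p.Coprime n :=
    (Nat.Prime.coprime_iff_not_dvd hp).2 fun hd =>
      absurd (hp.dvd_factorial.1 (hp.dvd_of_dvd_pow (hd.trans hm))) (not_le.2 hmp)
  have hmod : p ^ k % n = 1 % n := by
    rw [Nat.pow_mod]
    exact h _ (Nat.mod_lt _ hn) ((Nat.mod_modEq p n).gcd_eq.trans hcop)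
  exact (Nat.modEq_iff_dvd' (Nat.one_le_pow _ _ hp.pos)).1 hmod.symm

/-- A number dividing every `p ^ k - 1` divides the gcd of two of these values. -/
theorem dvd_gcd_pow_sub_one {k m d : ℕ} (h : ∀ p : ℕ, p.Prime → m < p → d ∣ p ^ k - 1)
    (p q : ℕ) (hp : p.Prime) (hq : q.Prime) (hmp : m < p) (hmq : m < q) :
    d ∣ Nat.gcd (p ^ k - 1) (q ^ k - 1) :=
  Nat.dvd_gcd (h p hp hmp) (h q hq hmq)

/-- The gcd of `{p^2 - 1 : p prime, p > 3}` is `24`, the gcd of `{p^4 - 1 : p prime, p > 5}`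
is `240`, the gcd of `{p^6 - 1 : p prime, p > 7}` is `504`, and the gcd of
`{p^8 - 1 : p prime, p > 9}` is `480`.  Each gcd is expressed by the characterization:
it divides every element of the set, and every common divisor of the set divides it. -/
theorem gcd_small_cases :
    ((∀ p : ℕ, p.Prime → 3 < p → 24 ∣ p ^ 2 - 1) ∧
      (∀ d : ℕ, (∀ p : ℕ, p.Prime → 3 < p → d ∣ p ^ 2 - 1) → d ∣ 24)) ∧
    ((∀ p : ℕ, p.Prime → 5 < p → 240 ∣ p ^ 4 - 1) ∧
      (∀ d : ℕ, (∀ p : ℕ, p.Prime → 5 < p → d ∣ p ^ 4 - 1) → d ∣ 240)) ∧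
    ((∀ p : ℕ, p.Prime → 7 < p → 504 ∣ p ^ 6 - 1) ∧
      (∀ d : ℕ, (∀ p : ℕ, p.Prime → 7 < p → d ∣ p ^ 6 - 1) → d ∣ 504)) ∧
    ((∀ p : ℕ, p.Prime → 9 < p → 480 ∣ p ^ 8 - 1) ∧
      (∀ d : ℕ, (∀ p : ℕ, p.Prime → 9 < p → d ∣ p ^ 8 - 1) → d ∣ 480)) := by
  refine ⟨⟨fun p hp h => ?_, fun d h => ?_⟩, ⟨fun p hp h => ?_, fun d h => ?_⟩,
    ⟨fun p hp h => ?_, fun d h => ?_⟩, ⟨fun p hp h => ?_, fun d h => ?_⟩⟩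
  · exact hp.dvd_pow_sub_one_of_forall_residue (j := 3) h (by norm_num)
      (by decide +kernel) (by decide +kernel)
  · simpa using dvd_gcd_pow_sub_one h 5 7 (by norm_num) (by norm_num) (by norm_num) (by norm_num)
  · exact hp.dvd_pow_sub_one_of_forall_residue (j := 3) h (by norm_num)
      (by decide +kernel) (by decide +kernel)
  · simpa using dvd_gcd_pow_sub_one h 7 11 (by norm_num) (by norm_num) (by norm_num) (by norm_num)
  · exact hp.dvd_pow_sub_one_of_forall_residue (j := 3) h (by norm_num)
      (by decide +kernel) (by decide +kernel)
  · simpa using dvd_gcd_pow_sub_one h 11 13 (by norm_num) (by norm_num) (by norm_num) (by norm_num)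
  · exact hp.dvd_pow_sub_one_of_forall_residue (j := 3) h (by norm_num)
      (by decide +kernel) (by decide +kernel)
  · simpa using dvd_gcd_pow_sub_one h 11 13 (by norm_num) (by norm_num) (by norm_num) (by norm_num)
end

section
/- Let p be a prime, R a commutative ring, and u ∈ R an element with u^p = 1 such that u − 1 is nilpotent. Then p·(u − 1) lies in the ideal of R generated by (u − 1)^p; that is, p(u−1) is divisible by (u−1)^p in R. -/
/-- The first-order refinement of `exists_add_pow_prime_eq` at `1`: the cofactor of `p * x`
is congruent to `1` modulo `x`. -/
theorem exists_one_add_pow_prime_eq {R : Type*} [CommRing R] {p : ℕ} (hp : p.Prime) (x : R) :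
    ∃ s, (1 + x) ^ p = 1 + x ^ p + p * x * (1 + x * s) := by
  have hIoo : Finset.Ioo 0 p = insert 1 (Finset.Ioo 1 p) := by
    ext k
    have := hp.one_lt
    simp only [Finset.mem_Ioo, Finset.mem_insert]
    omega
  have hdvd : x ∣ ∑ k ∈ Finset.Ioo 1 p,
      x ^ (k - 1) * 1 ^ (p - k - 1) * ((p.choose k / p : ℕ) : R) := by
    refine Finset.dvd_sum fun k hk => ?_
    have hk1 : k - 1 ≠ 0 := by
      have := (Finset.mem_Ioo.mp hk).1
      omega
    exact ((dvd_pow_self x hk1).mul_right _).mul_right _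
  obtain ⟨s, hs⟩ := hdvd
  refine ⟨s, ?_⟩
  rw [add_comm 1 x, add_pow_prime_eq hp x 1, hIoo, Finset.sum_insert (by simp), hs]
  simp [Nat.div_self hp.pos, add_comm]

/-- Let `p` be a prime, `R` a commutative ring and `u ∈ R` with `u^p = 1` and `u - 1`
nilpotent.  Then `p (u - 1)` lies in the ideal generated by `(u - 1)^p`, i.e.
`p (u - 1)` is divisible by `(u - 1)^p` in `R`. -/
theorem prime_mul_sub_one_mem_span (p : ℕ) (hp : p.Prime) {R : Type*} [CommRing R]
    (u : R) (hu : u ^ p = 1) (hnil : IsNilpotent (u - 1)) :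
    (p : R) * (u - 1) ∈ Ideal.span {(u - 1) ^ p} := by
  obtain ⟨s, hs⟩ := exists_one_add_pow_prime_eq hp (u - 1)
  rw [add_sub_cancel, hu] at hs
  have hunit : IsUnit (1 + (u - 1) * s) :=
    ((Commute.all (u - 1) s).isNilpotent_mul_right hnil).isUnit_one_add
  rw [Ideal.mem_span_singleton, ← hunit.dvd_mul_right]
  exact ⟨-1, by linear_combination -hs⟩
end
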